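/- arXiv:1812.07769 — 8 statements merged into one kernel-verified Lean document; each statement's English description precedes it below -/
import Mathlib

section
/- Let a ∈ (0,1) and b = 1 − a. For p, q > 0 and x ∈ [0,1], let B_x(p,q) = ∫₀ˣ t^{p−1}(1−t)^{q−1} dt denote the incomplete beta integral, and let B(p,q) = B_1(p,q) denote the complete beta integral. Let (c)_n denote the rising factorial (Pochhammer symbol) (c)_n = c(c+1)⋯(c+n−1), with (c)_0 = 1, and define H(a) = Σ_{n=0}^∞ (a/2)_n · ((a+1)/2)_n² / ( ((a/2)+1)_n² · n! ). Then ∫₀^{π/2} B_{sin²φ}(a/2, b/2) dφ = (B(a/2 + 1/2, 1/2) / a) · H(a). -/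
open Real

/-- Pochhammer symbol (rising factorial): `(c)ₙ = c(c+1)⋯(c+n−1)`, with `(c)₀ = 1`. -/
noncomputable def poch (c : ℝ) (n : ℕ) : ℝ := ∏ k ∈ Finset.range n, (c + k)

/-- Incomplete beta integral `B_x(p,q) = ∫₀ˣ t^{p−1}(1−t)^{q−1} dt`. -/
noncomputable def incBeta (p q x : ℝ) : ℝ := ∫ t in (0:ℝ)..x, t ^ (p - 1) * (1 - t) ^ (q - 1)

/-- Complete beta integral `B(p,q) = B₁(p,q)`. -/
noncomputable def betaInt (p q : ℝ) : ℝ := incBeta p q 1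

/-- The hypergeometric sum
`H(a) = Σ_{n=0}^∞ (a/2)_n ((a+1)/2)_n² / ( ((a/2)+1)_n² n! )`. -/
noncomputable def H (a : ℝ) : ℝ :=
  ∑' n : ℕ, poch (a / 2) n * (poch ((a + 1) / 2) n) ^ 2 /
    ((poch (a / 2 + 1) n) ^ 2 * (Nat.factorial n))

open MeasureTheory Set

lemma poch_nonneg {c : ℝ} (hc : 0 ≤ c) (n : ℕ) : 0 ≤ poch c n :=
  Finset.prod_nonneg fun _ _ => by positivity

lemma poch_pos {c : ℝ} (hc : 0 < c) (n : ℕ) : 0 < poch c n :=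
  Finset.prod_pos fun _ _ => by positivity

lemma poch_succ (c : ℝ) (n : ℕ) : poch c (n + 1) = poch c n * (c + n) :=
  Finset.prod_range_succ _ _

lemma add_mul_poch (c : ℝ) (n : ℕ) : (c + n) * poch c n = c * poch (c + 1) n := by
  induction n with
  | zero => simp [poch]
  | succ n ih =>
    rw [poch_succ, poch_succ]
    push_cast
    linear_combination (c + n + 1) * ih

lemma poch_eq_ascPochhammer_eval (c : ℝ) (n : ℕ) : poch c n = (ascPochhammer ℝ n).eval c := by
  induction n with
  | zero => simp [poch]
  | succ n ih => rw [poch_succ, ascPochhammer_succ_eval, ih]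

/-- The negative binomial series in terms of the Pochhammer symbol. -/
lemma hasSum_poch_mul_pow (r : ℝ) {t : ℝ} (ht : |t| < 1) :
    HasSum (fun n : ℕ => poch r n / n.factorial * t ^ n) ((1 - t) ^ (-r)) := by
  have h := (one_div_one_sub_rpow_hasFPowerSeriesOnBall_zero r).hasSum (y := t)
    (by simpa [enorm_eq_nnnorm, ← NNReal.coe_lt_coe] using ht)
  have h1 : 0 ≤ 1 - t := by linarith [(abs_lt.mp ht).2]
  simp only [zero_add, one_div, ← Real.rpow_neg h1] at h
  convert! h using 1
  ext n
  have hc : Ring.choose (r + n - 1) n = poch r n / n.factorial := by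
    have := Ring.factorial_nsmul_multichoose_eq_ascPochhammer r n
    rw [Polynomial.ascPochhammer_smeval_eq_eval, ← poch_eq_ascPochhammer_eval] at this
    rw [Ring.choose, show r + n - 1 - n + 1 = r by ring, ← this, nsmul_eq_mul]
    field_simp
  simp [hc, mul_comm]

lemma intervalIntegrable_beta {p q : ℝ} (hp : 0 < p) (hq : 0 < q) :
    IntervalIntegrable (fun t : ℝ => t ^ (p - 1) * (1 - t) ^ (q - 1)) volume 0 1 := by
  have h := (Complex.betaIntegral_convergent (u := p) (v := q) (by simpa) (by simpa)).norm
  refine h.congr_ae ?_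
  rw [uIoc_of_le zero_le_one, ← restrict_Ioo_eq_restrict_Ioc]
  filter_upwards [ae_restrict_mem measurableSet_Ioo] with t ht
  have h1 : (1 : ℂ) - t = ((1 - t : ℝ) : ℂ) := by simp
  rw [norm_mul, h1, Complex.norm_cpow_eq_rpow_re_of_pos ht.1,
    Complex.norm_cpow_eq_rpow_re_of_pos (by linarith [ht.2])]
  simp

lemma integral_sin_rpow_add_two {s : ℝ} (hs : 0 ≤ s) :
    ∫ φ in (0:ℝ)..(π / 2), sin φ ^ (s + 2) =
      (s + 1) / (s + 2) * ∫ φ in (0:ℝ)..(π / 2), sin φ ^ s := by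
  have hd : ∀ φ ∈ uIcc 0 (π / 2), HasDerivAt (fun φ => sin φ ^ (s + 1) * cos φ)
      ((s + 1) * sin φ ^ s - (s + 2) * sin φ ^ (s + 2)) φ := by
    intro φ hφ
    rw [uIcc_of_le (by positivity)] at hφ
    have h0 : 0 ≤ sin φ := sin_nonneg_of_nonneg_of_le_pi hφ.1 (by linarith [hφ.2, pi_pos])
    have := ((hasDerivAt_sin φ).rpow_const (p := s + 1) (Or.inr (by linarith))).mul
      (hasDerivAt_cos φ)
    refine this.congr_deriv ?_
    rw [add_sub_cancel_right, Real.rpow_add_of_nonneg h0 hs zero_le_two,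
      Real.rpow_add_of_nonneg h0 hs zero_le_one, Real.rpow_one, Real.rpow_two]
    linear_combination (s + 1) * sin φ ^ s * sin_sq_add_cos_sq φ
  have hc : ∀ u : ℝ, 0 ≤ u → IntervalIntegrable (fun φ => sin φ ^ u) volume 0 (π / 2) :=
    fun u hu => (continuous_sin.rpow_const fun _ => Or.inr hu).intervalIntegrable _ _
  have h1 := (hc s hs).const_mul (s + 1)
  have h2 := (hc (s + 2) (by linarith)).const_mul (s + 2)
  have h := intervalIntegral.integral_eq_sub_of_hasDerivAt hd (h1.sub h2)
  rw [intervalIntegral.integral_sub h1 h2, intervalIntegral.integral_const_mul,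
    intervalIntegral.integral_const_mul] at h
  simp [Real.zero_rpow (by linarith : s + 1 ≠ 0)] at h
  field_simp
  linarith

lemma integral_sin_rpow {s : ℝ} (hs : 0 < s) :
    ∫ φ in (0:ℝ)..(π / 2), sin φ ^ s = betaInt (s / 2 + 1 / 2) (1 / 2) / 2 := by
  set g : ℝ → ℝ := fun t => t ^ (s / 2 + 1 / 2 - 1) * (1 - t) ^ ((1 : ℝ) / 2 - 1) with hg
  have hpi : (0 : ℝ) ≤ π / 2 := by positivity
  have hsin : ∀ φ ∈ Ioo 0 (π / 2), sin φ ^ 2 ∈ Ioo (0 : ℝ) 1 := fun φ hφ => by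
    have h1 := sin_pos_of_pos_of_lt_pi hφ.1 (by linarith [hφ.2])
    have h2 := cos_pos_of_mem_Ioo ⟨by linarith [hφ.1], hφ.2⟩
    have := sin_sq_add_cos_sq φ
    constructor <;> nlinarith
  have hEq : ∀ φ ∈ Ioo 0 (π / 2),
      (g ∘ fun φ => sin φ ^ 2) φ * (2 * sin φ * cos φ) = 2 * sin φ ^ s := fun φ hφ => by
    have h1 := sin_pos_of_pos_of_lt_pi hφ.1 (by linarith [hφ.2])
    have h2 := cos_pos_of_mem_Ioo ⟨by linarith [hφ.1], hφ.2⟩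
    have h3 : 1 - sin φ ^ 2 = cos φ ^ 2 := by linarith [sin_sq_add_cos_sq φ]
    simp only [hg, Function.comp, h3]
    rw [← Real.rpow_natCast_mul h1.le, ← Real.rpow_natCast_mul h2.le]
    have e1 : ((2 : ℕ) : ℝ) * (s / 2 + 1 / 2 - 1) = s - 1 := by push_cast; ring
    have e2 : ((2 : ℕ) : ℝ) * (1 / 2 - 1) = -1 := by norm_num
    rw [e1, e2, Real.rpow_sub_one h1.ne', Real.rpow_neg_one]
    field_simp
  have himg : (fun φ => sin φ ^ 2) '' uIcc 0 (π / 2) ⊆ Icc 0 1 := by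
    rintro _ ⟨φ, -, rfl⟩
    exact ⟨sq_nonneg _, sin_sq_le_one φ⟩
  have h := intervalIntegral.integral_comp_mul_deriv''' (a := 0) (b := π / 2)
    (f := fun φ => sin φ ^ 2) (f' := fun φ => 2 * sin φ * cos φ) (g := g)
    (by fun_prop) (fun φ _ => by
      simpa using ((hasDerivAt_sin φ).fun_pow 2).hasDerivWithinAt)
    (by
      rw [min_eq_left hpi, max_eq_right hpi]
      refine ContinuousOn.mono (s := Ioo 0 1) ?_ (by rintro _ ⟨φ, hφ, rfl⟩; exact hsin φ hφ)
      intro t ht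
      refine (ContinuousAt.mul (ContinuousAt.rpow_const continuousAt_id (Or.inl ht.1.ne'))
        (ContinuousAt.rpow_const (by fun_prop) (Or.inl ?_))).continuousWithinAt
      have := ht.2
      simp; linarith)
    (((intervalIntegrable_iff_integrableOn_Icc_of_le zero_le_one).1
      (intervalIntegrable_beta (by linarith) (by norm_num))).mono_set himg)
    (by
      rw [uIcc_of_le hpi, integrableOn_Icc_iff_integrableOn_Ioo]
      refine IntegrableOn.congr_fun ?_ (fun φ hφ => (hEq φ hφ).symm) measurableSet_Ioo
      refine (Continuous.integrableOn_Icc (a := 0) (b := π / 2) ?_).mono_set Ioo_subset_Icc_self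
      exact continuous_const.mul (continuous_sin.rpow_const fun _ => Or.inr hs.le))
  simp only [sin_zero, sin_pi_div_two, ne_eq, OfNat.ofNat_ne_zero, not_false_eq_true, zero_pow,
    one_pow] at h
  rw [betaInt, incBeta, ← h, intervalIntegral.integral_of_le hpi, intervalIntegral.integral_of_le hpi,
    integral_Ioc_eq_integral_Ioo, integral_Ioc_eq_integral_Ioo,
    setIntegral_congr_fun measurableSet_Ioo hEq, integral_const_mul]
  ring

lemma integral_sin_rpow_add_two_mul {s : ℝ} (hs : 0 < s) (n : ℕ) :
    ∫ φ in (0:ℝ)..(π / 2), sin φ ^ (s + 2 * n) =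
      betaInt (s / 2 + 1 / 2) (1 / 2) / 2 * (poch ((s + 1) / 2) n / poch (s / 2 + 1) n) := by
  induction n with
  | zero => simp [poch, integral_sin_rpow hs]
  | succ n ih =>
    have := poch_pos (by positivity : 0 < s / 2 + 1) n
    rw [show s + 2 * ((n + 1 : ℕ) : ℝ) = s + 2 * n + 2 by push_cast; ring,
      integral_sin_rpow_add_two (by positivity), ih, poch_succ, poch_succ]
    field_simp
    ring

lemma hasSum_incBeta {p q x : ℝ} (hp : 0 < p) (hq : 0 < q) (hq1 : q ≤ 1) (hx0 : 0 ≤ x)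
    (hx1 : x ≤ 1) :
    HasSum (fun n : ℕ => poch (1 - q) n / n.factorial / (p + n) * x ^ (p + n))
      (incBeta p q x) := by
  set c : ℕ → ℝ := fun n => poch (1 - q) n / n.factorial with hc
  have hc0 : ∀ n, 0 ≤ c n := fun n => div_nonneg (poch_nonneg (by linarith) n) (by positivity)
  have hterm : ∀ n : ℕ, IntervalIntegrable (fun t : ℝ => c n * t ^ (p + n - 1)) volume 0 x :=
    fun n => (intervalIntegral.intervalIntegrable_rpow' (by
      have : (0 : ℝ) ≤ n := by positivity
      linarith)).const_mul _
  have hval : ∀ n : ℕ, ∫ t in Ioo 0 x, c n * t ^ (p + n - 1) = c n / (p + n) * x ^ (p + n) := by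
    intro n
    have hn : (0 : ℝ) ≤ n := by positivity
    rw [← integral_Ioc_eq_integral_Ioo, ← intervalIntegral.integral_of_le hx0,
      intervalIntegral.integral_const_mul, integral_rpow (Or.inl (by linarith)),
      sub_add_cancel, Real.zero_rpow (by positivity)]
    ring
  have hint : ∀ n : ℕ, IntegrableOn (fun t : ℝ => c n * t ^ (p + n - 1)) (Ioo 0 x) := fun n =>
    ((intervalIntegrable_iff_integrableOn_Ioo_of_le hx0).1 (hterm n))
  have hpt : ∀ t ∈ Ioo 0 x, HasSum (fun n : ℕ => c n * t ^ (p + n - 1))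
      (t ^ (p - 1) * (1 - t) ^ (q - 1)) := by
    intro t ht
    have h := (hasSum_poch_mul_pow (1 - q) (t := t)
      (by rw [abs_of_pos ht.1]; linarith [ht.2])).mul_left (t ^ (p - 1))
    rw [neg_sub] at h
    convert! h using 1
    ext n
    rw [show p + n - 1 = p - 1 + n by ring, Real.rpow_add_natCast ht.1.ne']
    ring
  have hnonneg : ∀ n : ℕ, ∀ t ∈ Ioo 0 x, 0 ≤ c n * t ^ (p + n - 1) := fun n t ht =>
    mul_nonneg (hc0 n) (Real.rpow_nonneg ht.1.le _)
  have hbeta : IntegrableOn (fun t : ℝ => t ^ (p - 1) * (1 - t) ^ (q - 1)) (Ioo 0 x) :=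
    ((intervalIntegrable_iff_integrableOn_Ioo_of_le zero_le_one).1
      (intervalIntegrable_beta hp hq)).mono_set (Ioo_subset_Ioo_right hx1)
  have hnorm : ∀ n : ℕ, ∫ t in Ioo 0 x, ‖c n * t ^ (p + n - 1)‖ =
      ∫ t in Ioo 0 x, c n * t ^ (p + n - 1) := fun n =>
    setIntegral_congr_fun measurableSet_Ioo fun t ht => Real.norm_of_nonneg (hnonneg n t ht)
  have hsum : Summable fun n : ℕ => ∫ t in Ioo 0 x, ‖c n * t ^ (p + n - 1)‖ := by
    refine summable_of_sum_range_le (c := ∫ t in Ioo 0 x, t ^ (p - 1) * (1 - t) ^ (q - 1))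
      (fun n => by positivity) fun N => ?_
    simp only [hnorm]
    rw [← integral_finsetSum _ fun n _ => hint n]
    refine setIntegral_mono_on (integrable_finsetSum _ fun n _ => hint n) hbeta
      measurableSet_Ioo fun t ht => ?_
    exact sum_le_hasSum _ (fun n _ => hnonneg n t ht) (hpt t ht)
  have h := hasSum_integral_of_summable_integral_norm hint hsum
  simp only [hval] at h
  convert! h using 1
  rw [incBeta, intervalIntegral.integral_of_le hx0, integral_Ioc_eq_integral_Ioo]
  exact setIntegral_congr_fun measurableSet_Ioo fun t ht => (hpt t ht).tsum_eq.symm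

theorem stmt0 (a b : ℝ) (ha : a ∈ Set.Ioo (0 : ℝ) 1) (hb : b = 1 - a) :
    ∫ φ in (0:ℝ)..(π / 2), incBeta (a / 2) (b / 2) (Real.sin φ ^ 2) =
      betaInt (a / 2 + 1 / 2) (1 / 2) / a * H a := by
  obtain ⟨ha0, ha1⟩ := ha
  subst hb
  have hpi : (0 : ℝ) ≤ π / 2 := by positivity
  set c : ℕ → ℝ := fun n => poch ((a + 1) / 2) n / n.factorial / (a / 2 + n) with hc
  have hc0 : ∀ n, 0 ≤ c n := fun n =>
    div_nonneg (div_nonneg (poch_nonneg (by linarith) n) (by positivity)) (by positivity)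
  have hser : ∀ x : ℝ, 0 ≤ x → x ≤ 1 →
      HasSum (fun n : ℕ => c n * x ^ (a / 2 + n)) (incBeta (a / 2) ((1 - a) / 2) x) := by
    intro x hx0 hx1
    have h := hasSum_incBeta (p := a / 2) (q := (1 - a) / 2) (by linarith) (by linarith)
      (by linarith) hx0 hx1
    rwa [show 1 - (1 - a) / 2 = (a + 1) / 2 by ring] at h
  have hcsum : Summable c := by simpa using (hser 1 zero_le_one le_rfl).summable
  have hcont : ∀ n : ℕ, Continuous fun φ : ℝ => c n * (sin φ ^ 2) ^ (a / 2 + n) := fun n =>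
    continuous_const.mul ((continuous_sin.pow 2).rpow_const fun _ => Or.inr (by positivity))
  have hval : ∀ n : ℕ, ∫ φ in (0:ℝ)..(π / 2), c n * (sin φ ^ 2) ^ (a / 2 + n) =
      betaInt (a / 2 + 1 / 2) (1 / 2) / a * (poch (a / 2) n * (poch ((a + 1) / 2) n) ^ 2 /
        ((poch (a / 2 + 1) n) ^ 2 * (Nat.factorial n))) := by
    intro n
    have hI : ∫ φ in (0:ℝ)..(π / 2), (sin φ ^ 2) ^ (a / 2 + n) =
        ∫ φ in (0:ℝ)..(π / 2), sin φ ^ (a + 2 * n) := by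
      refine intervalIntegral.integral_congr fun φ hφ => ?_
      rw [uIcc_of_le hpi] at hφ
      have h0 : 0 ≤ sin φ := sin_nonneg_of_nonneg_of_le_pi hφ.1 (by linarith [hφ.2, pi_pos])
      rw [← Real.rpow_natCast_mul h0]
      congr 1
      push_cast
      ring
    rw [intervalIntegral.integral_const_mul, hI, integral_sin_rpow_add_two_mul ha0]
    have h1 := poch_pos (by positivity : 0 < a / 2 + 1) n
    have h2 : poch (a / 2) n = a / 2 * poch (a / 2 + 1) n / (a / 2 + n) := by
      rw [← add_mul_poch]
      field_simp
    rw [h2]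
    simp only [hc]
    field_simp
  have hdom := intervalIntegral.hasSum_integral_of_dominated_convergence
    (a := 0) (b := π / 2) (μ := volume) (F := fun (n : ℕ) φ => c n * (sin φ ^ 2) ^ (a / 2 + n))
    (f := fun φ => incBeta (a / 2) ((1 - a) / 2) (sin φ ^ 2)) (fun n _ => c n)
    (fun n => (hcont n).aestronglyMeasurable)
    (fun n => ae_of_all _ fun φ _ => by
      rw [Real.norm_of_nonneg (mul_nonneg (hc0 n) (by positivity))]
      exact mul_le_of_le_one_right (hc0 n)
        (Real.rpow_le_one (sq_nonneg _) (sin_sq_le_one φ) (by positivity)))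
    (ae_of_all _ fun _ _ => hcsum) intervalIntegrable_const
    (ae_of_all _ fun φ _ => hser _ (sq_nonneg _) (sin_sq_le_one φ))
  simp only [hval] at hdom
  rw [← hdom.tsum_eq, tsum_mul_left, H]
end

section
/- Let V be a real inner product space, let v₀ ∈ V be a unit vector, and let v_i, v_j ∈ V satisfy ⟨v_i, v₀⟩ = ⟨v_i, v_i⟩ = x and ⟨v_j, v₀⟩ = ⟨v_j, v_j⟩ = y with x, y ∈ (0,1). Write v_i = x v₀ + √(x − x²) w_i and v_j = y v₀ + √(y − y²) w_j, where w_i, w_j are unit vectors orthogonal to v₀, and set cos θ = ⟨w_i, w_j⟩. If the SDP constraints ⟨v_i, v_j⟩ ≥ 0 and ⟨v₀ − v_i, v₀ − v_j⟩ ≥ 0 hold, then cos θ ≥ −√( x y / ((1−x)(1−y)) ) and cos θ ≥ −√( (1−x)(1−y) / (x y) ). -/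
open Real RealInnerProductSpace

/-- If `a + √(ab) c ≥ 0` with `a, b > 0`, then `c ≥ -√(a / b)`. -/
lemma neg_sqrt_div_le_of_nonneg_add {a b c : ℝ} (ha : 0 < a) (hb : 0 < b)
    (h : 0 ≤ a + Real.sqrt (a * b) * c) : -Real.sqrt (a / b) ≤ c := by
  have hpos : 0 < Real.sqrt (a * b) := Real.sqrt_pos.2 (mul_pos ha hb)
  have hmul : Real.sqrt (a * b) * Real.sqrt (a / b) = a := by
    rw [← Real.sqrt_mul (mul_pos ha hb).le, show a * b * (a / b) = a ^ 2 by field_simp,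
      Real.sqrt_sq ha.le]
  refine le_of_mul_le_mul_left ?_ hpos
  linarith

theorem stmt9 {V : Type*} [NormedAddCommGroup V] [InnerProductSpace ℝ V]
    (v₀ vi vj wi wj : V) (x y θ : ℝ)
    (hv₀ : ⟪v₀, v₀⟫ = (1 : ℝ))
    (hx : x ∈ Set.Ioo (0 : ℝ) 1) (hy : y ∈ Set.Ioo (0 : ℝ) 1)
    (hix : ⟪vi, v₀⟫ = x) (hii : ⟪vi, vi⟫ = x)
    (hjy : ⟪vj, v₀⟫ = y) (hjj : ⟪vj, vj⟫ = y)
    (hwi1 : ⟪wi, wi⟫ = (1 : ℝ)) (hwj1 : ⟪wj, wj⟫ = (1 : ℝ))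
    (hwi0 : ⟪wi, v₀⟫ = (0 : ℝ)) (hwj0 : ⟪wj, v₀⟫ = (0 : ℝ))
    (hvi : vi = x • v₀ + Real.sqrt (x - x ^ 2) • wi)
    (hvj : vj = y • v₀ + Real.sqrt (y - y ^ 2) • wj)
    (hθ : Real.cos θ = ⟪wi, wj⟫)
    (sdp1 : (0 : ℝ) ≤ ⟪vi, vj⟫)
    (sdp2 : (0 : ℝ) ≤ ⟪v₀ - vi, v₀ - vj⟫) :
    Real.cos θ ≥ -Real.sqrt (x * y / ((1 - x) * (1 - y))) ∧
      Real.cos θ ≥ -Real.sqrt ((1 - x) * (1 - y) / (x * y)) := by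
  obtain ⟨hx0, hx1⟩ := hx
  obtain ⟨hy0, hy1⟩ := hy
  have hx1' : 0 < 1 - x := sub_pos.2 hx1
  have hy1' : 0 < 1 - y := sub_pos.2 hy1
  have hsqrt : Real.sqrt (x - x ^ 2) * Real.sqrt (y - y ^ 2) =
      Real.sqrt (x * y * ((1 - x) * (1 - y))) := by
    rw [← Real.sqrt_mul (by nlinarith)]
    congr 1
    ring
  have hij : ⟪vi, vj⟫ = x * y + Real.sqrt (x * y * ((1 - x) * (1 - y))) * Real.cos θ := by
    rw [← hsqrt, hθ, hvi, hvj]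
    simp only [inner_add_left, inner_add_right, real_inner_smul_left, real_inner_smul_right,
      hv₀, hwi0, real_inner_comm wj v₀, hwj0]
    ring
  have hneg : ⟪v₀ - vi, v₀ - vj⟫ = 1 - x - y + ⟪vi, vj⟫ := by
    simp only [inner_sub_left, inner_sub_right, hv₀, hix, ← real_inner_comm v₀ vj, hjy]
    ring
  constructor
  · exact neg_sqrt_div_le_of_nonneg_add (by positivity) (by positivity) (hij ▸ sdp1)
  · refine neg_sqrt_div_le_of_nonneg_add (by positivity) (by positivity) ?_
    rw [mul_comm ((1 - x) * (1 - y))]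
    linarith
end

section
/- Fix ρ ∈ [0,1] and define g₁ : (0,1)² → ℝ by g₁(x,y) = 1 − x y − ρ √(x − x²) √(y − y²). Then for every (x,y) ∈ (0,1)², the second partial derivatives of g₁ satisfy (∂²g₁/∂x²)(x,y) + (∂²g₁/∂y²)(x,y) + 2ρ (∂²g₁/∂x∂y)(x,y) ≥ 0, i.e. g₁ is a subsolution of the elliptic operator L = ∂²/∂x² + ∂²/∂y² + 2ρ ∂²/∂x∂y on the open unit square. -/
open Real

/-- `g₁(x,y) = 1 − xy − ρ √(x − x²) √(y − y²)`. -/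
noncomputable def g₁ (ρ x y : ℝ) : ℝ :=
  1 - x * y - ρ * Real.sqrt (x - x ^ 2) * Real.sqrt (y - y ^ 2)

theorem hasDerivAt_sqrt_sub_sq {x : ℝ} (hx : x ∈ Set.Ioo (0 : ℝ) 1) :
    HasDerivAt (fun t : ℝ => √(t - t ^ 2)) ((1 - 2 * x) / (2 * √(x - x ^ 2))) x := by
  have hpos : 0 < x - x ^ 2 := by nlinarith [hx.1, hx.2]
  have h : HasDerivAt (fun t : ℝ => t - t ^ 2) (1 - 2 * x) x := by
    simpa using (hasDerivAt_id x).fun_sub (hasDerivAt_pow 2 x)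
  exact h.sqrt hpos.ne'

theorem hasDerivAt_deriv_sqrt_sub_sq {x : ℝ} (hx : x ∈ Set.Ioo (0 : ℝ) 1) :
    HasDerivAt (fun t : ℝ => (1 - 2 * t) / (2 * √(t - t ^ 2)))
      (-1 / (4 * √(x - x ^ 2) ^ 3)) x := by
  have hpos : 0 < x - x ^ 2 := by nlinarith [hx.1, hx.2]
  have hs := Real.sqrt_pos.2 hpos
  have hsq := Real.sq_sqrt hpos.le
  have hnum : HasDerivAt (fun t : ℝ => 1 - 2 * t) (-2) x := by
    simpa using ((hasDerivAt_id x).const_mul 2).const_sub 1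
  refine (hnum.fun_div ((hasDerivAt_sqrt_sub_sq hx).const_mul 2)
    (by positivity)).congr_deriv ?_
  generalize √(x - x ^ 2) = s at hs hsq ⊢
  field_simp
  linear_combination (-16 : ℝ) * hsq

theorem g₁_comm (ρ x y : ℝ) : g₁ ρ x y = g₁ ρ y x := by
  unfold g₁
  ring

theorem hasDerivAt_g₁_right (ρ x : ℝ) {y : ℝ} (hy : y ∈ Set.Ioo (0 : ℝ) 1) :
    HasDerivAt (fun t => g₁ ρ x t)
      (-x - ρ * √(x - x ^ 2) * ((1 - 2 * y) / (2 * √(y - y ^ 2)))) y := by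
  have h := (((hasDerivAt_id y).const_mul x).const_sub 1).fun_sub
    ((hasDerivAt_sqrt_sub_sq hy).const_mul (ρ * √(x - x ^ 2)))
  simpa [g₁] using h

theorem deriv_deriv_g₁_right (ρ x : ℝ) {y : ℝ} (hy : y ∈ Set.Ioo (0 : ℝ) 1) :
    deriv (deriv (fun t => g₁ ρ x t)) y =
      ρ * √(x - x ^ 2) / (4 * √(y - y ^ 2) ^ 3) := by
  have heq : deriv (fun t => g₁ ρ x t) =ᶠ[nhds y]
      fun t => -x - ρ * √(x - x ^ 2) * ((1 - 2 * t) / (2 * √(t - t ^ 2))) := by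
    filter_upwards [isOpen_Ioo.mem_nhds hy] with t ht
    exact (hasDerivAt_g₁_right ρ x ht).deriv
  rw [heq.deriv_eq, (((hasDerivAt_deriv_sqrt_sub_sq hy).const_mul
    (ρ * √(x - x ^ 2))).const_sub (-x)).deriv]
  ring

theorem deriv_deriv_g₁_mixed (ρ : ℝ) {x y : ℝ} (hx : x ∈ Set.Ioo (0 : ℝ) 1)
    (hy : y ∈ Set.Ioo (0 : ℝ) 1) :
    deriv (fun s => deriv (fun t => g₁ ρ s t) y) x =
      -1 - ρ * ((1 - 2 * x) / (2 * √(x - x ^ 2))) * ((1 - 2 * y) / (2 * √(y - y ^ 2))) := by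
  simp_rw [(hasDerivAt_g₁_right ρ _ hy).deriv]
  exact ((hasDerivAt_id x).fun_neg.fun_sub (((hasDerivAt_sqrt_sub_sq hx).const_mul ρ).mul_const _)).deriv

theorem subsolution_inequality {ρ a b p q : ℝ} (hρ : ρ ∈ Set.Icc (0 : ℝ) 1) (ha : 0 < a)
    (hb : 0 < b) (hp : p ^ 2 + 4 * a ^ 2 = 1) (hq : q ^ 2 + 4 * b ^ 2 = 1) :
    0 ≤ b / (4 * a ^ 3) + a / (4 * b ^ 3) - 2 - ρ * p * q / (2 * a * b) := by
  have hpq : ρ * p * q ≤ (p ^ 2 + q ^ 2) / 2 := by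
    nlinarith [mul_nonneg (sub_nonneg.2 hρ.2) (add_nonneg (sq_nonneg p) (sq_nonneg q)),
      mul_nonneg hρ.1 (sq_nonneg (p - q))]
  have hcs : 4 * a * b + ρ * p * q ≤ 1 := by nlinarith [sq_nonneg (a - b)]
  have hid : b / (4 * a ^ 3) + a / (4 * b ^ 3) - 2 - ρ * p * q / (2 * a * b) =
      ((a ^ 2 - b ^ 2) ^ 2 / (a ^ 2 * b ^ 2) + 2 * (1 - (4 * a * b + ρ * p * q))) /
        (4 * a * b) := by
    field_simp
    ring
  rw [hid]
  have := sub_nonneg.2 hcs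
  positivity

/-- `g₁` is a subsolution of the elliptic operator
`L = ∂²/∂x² + ∂²/∂y² + 2ρ ∂²/∂x∂y` on the open unit square. -/
theorem stmt10 (ρ : ℝ) (hρ : ρ ∈ Set.Icc (0 : ℝ) 1) (x y : ℝ)
    (hx : x ∈ Set.Ioo (0 : ℝ) 1) (hy : y ∈ Set.Ioo (0 : ℝ) 1) :
    0 ≤ deriv (deriv (fun x' => g₁ ρ x' y)) x
        + deriv (deriv (fun y' => g₁ ρ x y')) y
        + 2 * ρ * deriv (fun x' => deriv (fun y' => g₁ ρ x' y') y) x := by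
  have hxpos : 0 < x - x ^ 2 := by nlinarith [hx.1, hx.2]
  have hypos : 0 < y - y ^ 2 := by nlinarith [hy.1, hy.2]
  have hp : (1 - 2 * x) ^ 2 + 4 * √(x - x ^ 2) ^ 2 = 1 := by
    rw [Real.sq_sqrt hxpos.le]; ring
  have hq : (1 - 2 * y) ^ 2 + 4 * √(y - y ^ 2) ^ 2 = 1 := by
    rw [Real.sq_sqrt hypos.le]; ring
  have hswap : (fun x' => g₁ ρ x' y) = fun x' => g₁ ρ y x' := funext fun t => g₁_comm ρ t y
  rw [deriv_deriv_g₁_mixed ρ hx hy, hswap, deriv_deriv_g₁_right ρ y hx,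
    deriv_deriv_g₁_right ρ x hy]
  have key := mul_nonneg hρ.1 (subsolution_inequality hρ (Real.sqrt_pos.2 hxpos)
    (Real.sqrt_pos.2 hypos) hp hq)
  refine key.trans_eq ?_
  ring
end

section
/- For all x, y ∈ [0,1] and all ρ ∈ [−1/2, 0], the polynomial inequality 1 + 2x² + 2y² + 2ρ − 2x − 2y − 4ρx − 4ρy + 8ρxy ≥ 0 holds. (Consequently, the function g₂(x,y) = 1 − xy − 2ρ(x − x²)(y − y²) satisfies L g₂ = −2ρ·(this polynomial) ≥ 0 for the elliptic operator L = ∂²/∂x² + ∂²/∂y² + 2ρ ∂²/∂x∂y.) -/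
theorem stmt11 (x y ρ : ℝ) (hx : x ∈ Set.Icc (0 : ℝ) 1) (hy : y ∈ Set.Icc (0 : ℝ) 1)
    (hρ : ρ ∈ Set.Icc (-(1 / 2) : ℝ) 0) :
    0 ≤ 1 + 2 * x ^ 2 + 2 * y ^ 2 + 2 * ρ - 2 * x - 2 * y - 4 * ρ * x - 4 * ρ * y
        + 8 * ρ * x * y := by
  obtain ⟨hρ₁, hρ₂⟩ := hρ
  have h₁ : 0 ≤ (1 / 2 + ρ) * ((2 * x - 1) ^ 2 + (2 * y - 1) ^ 2) :=
    mul_nonneg (by linarith) (by positivity)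
  have h₂ : 0 ≤ -ρ * (2 * x - 2 * y) ^ 2 :=
    mul_nonneg (by linarith) (sq_nonneg _)
  linarith
end

section
/- Let x, y ∈ [0,1] and ρ ∈ [−1/2, 0] satisfy the feasibility conditions x·y ≥ (1−x)(1−y)·ρ² and (1−x)(1−y) ≥ x·y·ρ². Then 1 − x y − 2ρ (x − x²)(y − y²) ≥ 0.8749 · ( 1 − x y − ρ √( (x − x²)(y − y²) ) ). -/
theorem stmt12 (x y ρ : ℝ) (hx : x ∈ Set.Icc (0 : ℝ) 1) (hy : y ∈ Set.Icc (0 : ℝ) 1)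
    (hρ : ρ ∈ Set.Icc (-(1 / 2) : ℝ) 0)
    (hfeas1 : x * y ≥ (1 - x) * (1 - y) * ρ ^ 2)
    (hfeas2 : (1 - x) * (1 - y) ≥ x * y * ρ ^ 2) :
    1 - x * y - 2 * ρ * (x - x ^ 2) * (y - y ^ 2) ≥
      0.8749 * (1 - x * y - ρ * Real.sqrt ((x - x ^ 2) * (y - y ^ 2))) := by
  obtain ⟨hx0, hx1⟩ := hx
  obtain ⟨hy0, hy1⟩ := hy
  obtain ⟨hρ0, hρ1⟩ := hρ
  have hp0 : 0 ≤ x * y := mul_nonneg hx0 hy0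
  have hp1 : x * y ≤ 1 := mul_le_one₀ hx1 hy0 hy1
  have hq0 : 0 ≤ (1 - x) * (1 - y) := mul_nonneg (by linarith) (by linarith)
  have hpq : (x - x ^ 2) * (y - y ^ 2) = (x * y) * ((1 - x) * (1 - y)) := by ring
  have hsum : 4 * (x * y) ≤ (1 + x * y - (1 - x) * (1 - y)) ^ 2 := by
    nlinarith [sq_nonneg (x - y)]
  have hsum0 : 0 ≤ 1 + x * y - (1 - x) * (1 - y) := by nlinarith
  rw [mul_assoc (2 * ρ), hpq]
  set s := √((x * y) * ((1 - x) * (1 - y))) with hs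
  have hs0 : 0 ≤ s := Real.sqrt_nonneg _
  have hs2 : s ^ 2 = (x * y) * ((1 - x) * (1 - y)) := Real.sq_sqrt (mul_nonneg hp0 hq0)
  rw [← hs2]
  have hρs : -ρ * s ≤ (1 - x) * (1 - y) := by
    refine (sq_le_sq₀ (mul_nonneg (by linarith) hs0) hq0).1 ?_
    calc (-ρ * s) ^ 2 = ρ ^ 2 * s ^ 2 := by ring
      _ = (x * y * ρ ^ 2) * ((1 - x) * (1 - y)) := by rw [hs2]; ring
      _ ≤ ((1 - x) * (1 - y)) * ((1 - x) * (1 - y)) :=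
        mul_le_mul_of_nonneg_right hfeas2 hq0
      _ = ((1 - x) * (1 - y)) ^ 2 := by ring
  generalize (1 - x) * (1 - y) = q at *
  generalize x * y = p at *
  rcases le_total p 0.617 with hp | hp
  · -- Replacing `ρ` by `-1/2` leaves a quadratic in `s`.
    have h : 0 ≤ (1 / 2 + ρ) * s := mul_nonneg (by linarith) hs0
    have h' : 0 ≤ -ρ * (s - 0.8749 / 4) ^ 2 := mul_nonneg (by linarith) (sq_nonneg _)
    nlinarith
  · -- Here `-ρ * s ≤ q`, and `q` is small compared with `1 - p`.
    have hq : 0.8749 * q ≤ 0.1251 * (1 - p) := by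
      by_contra! h
      have h1 : 1 + p - q ≤ 1 + p - 0.1429 * (1 - p) := by linarith
      have h2 := pow_le_pow_left₀ hsum0 h1 2
      nlinarith
    have h : 0 ≤ -ρ * s ^ 2 := mul_nonneg (by linarith) (sq_nonneg _)
    nlinarith
end

section
/- Let x, y ∈ [0,1] and ρ ∈ [−1, −1/2] satisfy the feasibility conditions x·y ≥ (1−x)(1−y)·ρ² and (1−x)(1−y) ≥ x·y·ρ². Then 1 − x y − (1/2)(1 + 5ρ)(x − x²)(y − y²)(x + y)(2 − x − y) ≥ 0.8749 · ( 1 − x y − ρ √( (x − x²)(y − y²) ) ). -/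
/-- An affine function of `r` that is nonnegative at `1 / 2` and at `1 / q` is nonnegative
in between. -/
lemma affine_nonneg_of_endpoints {P R q r : ℝ} (hq : 0 < q) (hr : 1 / 2 ≤ r) (hrq : r * q ≤ 1)
    (h₁ : 0 ≤ P + R * (1 / 2)) (h₂ : 0 ≤ q * P + R) : 0 ≤ P + R * r := by
  rcases le_total 0 R with hR | hR
  · nlinarith [mul_le_mul_of_nonneg_left hr hR]
  · have h : 0 ≤ q * (P + R * r) := by nlinarith [mul_le_mul_of_nonpos_left hrq hR]
    exact nonneg_of_mul_nonneg_right h hq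

/-- The slope at the extreme point `√(xy) + √((1-x)(1-y)) = 1` of the reduced difference. -/
lemma slope_bound {q r : ℝ} (hq₁ : 1 ≤ q) (hq₂ : q ≤ 2) (hr : 1 / 2 ≤ r) (hrq : r * q ≤ 1) :
    0 ≤ (0.1251 * q * (1 + q) ^ 4 + 4 * q ^ 2) + (0.8749 * (1 + q) ^ 4 - 20 * q ^ 2) * r := by
  obtain ⟨e, rfl⟩ : ∃ e, q = 1 + e := ⟨q - 1, by ring⟩
  have he : 0 ≤ e := by linarith
  have he' : 0 ≤ 1 - e := by linarith
  have h2 := mul_nonneg he he'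
  apply affine_nonneg_of_endpoints (by linarith) hr hrq
  · nlinarith [pow_nonneg he 2, pow_nonneg he 3, pow_nonneg he 4, pow_nonneg he 5]
  · nlinarith [pow_nonneg he 2, pow_nonneg he 3, pow_nonneg he 4, pow_nonneg he 5,
      pow_nonneg he 6]

/-- The value at the extreme point `√(xy) + √((1-x)(1-y)) = 1` of the reduced difference. -/
lemma value_bound {q r : ℝ} (hq₁ : 1 ≤ q) (hq₂ : q ≤ 2) (hr : 1 / 2 ≤ r) (hrq : r * q ≤ 1) :
    0 ≤ (0.1251 * (1 + 2 * q) * (1 + q) ^ 4 - 2 * q ^ 3) +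
      (10 * q ^ 3 - 0.8749 * q * (1 + q) ^ 4) * r := by
  obtain ⟨e, rfl⟩ : ∃ e, q = 1 + e := ⟨q - 1, by ring⟩
  have he : 0 ≤ e := by linarith
  have he' : 0 ≤ 1 - e := by linarith
  have h2 := mul_nonneg he he'
  apply affine_nonneg_of_endpoints (by linarith) hr hrq
  · nlinarith [pow_nonneg he 2, pow_nonneg he 3, pow_nonneg he 4, pow_nonneg he 5,
      mul_nonneg (pow_nonneg he 2) he', mul_nonneg (pow_nonneg he 3) he',
      mul_nonneg (pow_nonneg he 4) he']
  · have h : 0 ≤ 0.1251 * (1 + 2 * (1 + e)) * (1 + (1 + e)) ^ 4 + 2 * (5 - (1 + e)) * (1 + e) ^ 2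
        - 0.8749 * (1 + (1 + e)) ^ 4 := by
      nlinarith [pow_nonneg he 2, pow_nonneg he 3, pow_nonneg he 4, pow_nonneg he 5,
        mul_nonneg (pow_nonneg he 2) he', mul_nonneg (pow_nonneg he 3) he',
        mul_nonneg (pow_nonneg he 4) he']
    nlinarith [mul_nonneg (by linarith : (0 : ℝ) ≤ 1 + e) h]

/-- The difference of the two sides, in terms of `b = min (√(xy)) (√((1-x)(1-y)))` and of
`a = max (√(xy)) (√((1-x)(1-y)))`, is nonnegative. -/
lemma reduced_difference_nonneg {a b r : ℝ} (hb : 0 < b) (hba : b ≤ a) (hab : a + b ≤ 1)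
    (hr : 1 / 2 ≤ r) (hra : r * a ≤ b) :
    0 ≤ 0.1251 * (1 - a ^ 2) + 1 / 2 * (5 * r - 1) * (a * b) ^ 2 * (1 - (a ^ 2 - b ^ 2) ^ 2)
      - 0.8749 * r * (a * b) := by
  obtain ⟨q, rfl⟩ : ∃ q, a = q * b := ⟨a / b, by field_simp⟩
  have hq₁ : 1 ≤ q := by by_contra! h; nlinarith
  have hrq : r * q ≤ 1 := by by_contra! h; nlinarith
  have hq₂ : q ≤ 2 := by nlinarith
  have hslope := slope_bound hq₁ hq₂ hr hrq
  have hvalue := value_bound hq₁ hq₂ hr hrq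
  have hq : 0 < 1 + q := by linarith
  obtain ⟨n, hn⟩ : ∃ n, n = (b * (1 + q)) ^ 2 := ⟨_, rfl⟩
  have hn₀ : 0 ≤ n := hn ▸ sq_nonneg _
  have hn₁ : n ≤ 1 := by rw [hn]; exact pow_le_one₀ (by positivity) (by linarith)
  have hb2 : b ^ 2 = n / (1 + q) ^ 2 := by rw [hn]; field_simp
  have hd : 4 * q / (1 + q) ^ 2 ≤ 1 - ((q * b) ^ 2 - b ^ 2) ^ 2 := by
    have h : ((q * b) ^ 2 - b ^ 2) ^ 2 = n ^ 2 * ((q - 1) / (1 + q)) ^ 2 := by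
      rw [hn]; field_simp; ring
    have h' : 4 * q / (1 + q) ^ 2 = 1 - ((q - 1) / (1 + q)) ^ 2 := by field_simp; ring
    rw [h, h']
    nlinarith [sq_nonneg ((q - 1) / (1 + q)), pow_le_one₀ hn₀ hn₁ (n := 2)]
  have hS : 1 / 2 * (5 * r - 1) * (q * b * b) ^ 2 * (4 * q / (1 + q) ^ 2) ≤
      1 / 2 * (5 * r - 1) * (q * b * b) ^ 2 * (1 - ((q * b) ^ 2 - b ^ 2) ^ 2) :=
    mul_le_mul_of_nonneg_left hd (mul_nonneg (by linarith) (sq_nonneg _))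
  have key : 0 ≤ 0.1251 * (1 - (q * b) ^ 2)
      + 1 / 2 * (5 * r - 1) * (q * b * b) ^ 2 * (4 * q / (1 + q) ^ 2)
      - 0.8749 * r * (q * b * b) := by
    have e : 0.1251 * (1 - (q * b) ^ 2)
        + 1 / 2 * (5 * r - 1) * (q * b * b) ^ 2 * (4 * q / (1 + q) ^ 2)
        - 0.8749 * r * (q * b * b)
        = ((1 - n) * q * ((0.1251 * q * (1 + q) ^ 4 + 4 * q ^ 2)
            + (0.8749 * (1 + q) ^ 4 - 20 * q ^ 2) * r)
          + ((0.1251 * (1 + 2 * q) * (1 + q) ^ 4 - 2 * q ^ 3) +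
            (10 * q ^ 3 - 0.8749 * q * (1 + q) ^ 4) * r)
          + 2 * (5 * r - 1) * q ^ 3 * (1 - n) ^ 2) / (1 + q) ^ 6 := by
      have h : q * b * b = q * (n / (1 + q) ^ 2) := by rw [← hb2]; ring
      rw [h, mul_pow q b, hb2]
      field_simp
      ring
    rw [e]
    have h1 : 0 ≤ 1 - n := by linarith
    have h2 : 0 ≤ 5 * r - 1 := by linarith
    have h3 : 0 ≤ q := by linarith
    have h4 := mul_nonneg (mul_nonneg h1 h3) hslope
    have h5 : 0 ≤ 2 * (5 * r - 1) * q ^ 3 * (1 - n) ^ 2 := by positivity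
    exact div_nonneg (by linarith) (by positivity)
  linarith

theorem stmt13 (x y ρ : ℝ) (hx : x ∈ Set.Icc (0 : ℝ) 1) (hy : y ∈ Set.Icc (0 : ℝ) 1)
    (hρ : ρ ∈ Set.Icc (-1 : ℝ) (-(1 / 2)))
    (hfeas1 : x * y ≥ (1 - x) * (1 - y) * ρ ^ 2)
    (hfeas2 : (1 - x) * (1 - y) ≥ x * y * ρ ^ 2) :
    1 - x * y - 1 / 2 * (1 + 5 * ρ) * (x - x ^ 2) * (y - y ^ 2) * (x + y) * (2 - x - y) ≥
      0.8749 * (1 - x * y - ρ * Real.sqrt ((x - x ^ 2) * (y - y ^ 2))) := by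
  obtain ⟨hx₀, hx₁⟩ := hx
  obtain ⟨hy₀, hy₁⟩ := hy
  obtain ⟨-, hρ₁⟩ := hρ
  obtain ⟨r, rfl⟩ : ∃ r, ρ = -r := ⟨-ρ, by ring⟩
  have hr : 1 / 2 ≤ r := by linarith
  have hp : 0 ≤ x * y := mul_nonneg hx₀ hy₀
  have hm : 0 ≤ (1 - x) * (1 - y) := mul_nonneg (by linarith) (by linarith)
  obtain ⟨a, ha, ha2⟩ : ∃ a, 0 ≤ a ∧ a ^ 2 = x * y := ⟨_, Real.sqrt_nonneg _, Real.sq_sqrt hp⟩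
  obtain ⟨b, hb, hb2⟩ : ∃ b, 0 ≤ b ∧ b ^ 2 = (1 - x) * (1 - y) :=
    ⟨_, Real.sqrt_nonneg _, Real.sq_sqrt hm⟩
  have hs2 : (a * b) ^ 2 = (x - x ^ 2) * (y - y ^ 2) := by rw [mul_pow, ha2, hb2]; ring
  rw [← hs2, Real.sqrt_sq (mul_nonneg ha hb)]
  have hsum : a + b ≤ 1 := by
    have h : 2 * (a * b) ≤ x * (1 - y) + y * (1 - x) := by
      apply le_of_sq_le_sq _
        (add_nonneg (mul_nonneg hx₀ (by linarith)) (mul_nonneg hy₀ (by linarith)))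
      rw [mul_pow, hs2]
      nlinarith [sq_nonneg (x * (1 - y) - y * (1 - x))]
    exact le_of_sq_le_sq (by nlinarith) zero_le_one
  have hra : r * a ≤ b := le_of_sq_le_sq (by rw [mul_pow, ha2, hb2]; linarith) hb
  have hrb : r * b ≤ a := le_of_sq_le_sq (by rw [mul_pow, ha2, hb2]; linarith) ha
  have hu : (x + y) * (2 - x - y) = 1 - (a ^ 2 - b ^ 2) ^ 2 := by rw [ha2, hb2]; ring
  have hlhs : 1 - x * y
      - 1 / 2 * (1 + 5 * -r) * (x - x ^ 2) * (y - y ^ 2) * (x + y) * (2 - x - y)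
      = 1 - a ^ 2 + 1 / 2 * (5 * r - 1) * (a * b) ^ 2 * (1 - (a ^ 2 - b ^ 2) ^ 2) := by
    rw [← hu, hs2, ha2]; ring
  rw [hlhs, ← ha2]
  rcases le_total b a with hba | hab
  · rcases hb.eq_or_lt with rfl | hb'
    · nlinarith
    · linarith [reduced_difference_nonneg hb' hba hsum hr hra]
  · rcases ha.eq_or_lt with rfl | ha'
    · nlinarith
    · have h := reduced_difference_nonneg ha' hab (by linarith) hr hrb
      have h' : a ^ 2 ≤ b ^ 2 := pow_le_pow_left₀ ha hab 2
      rw [mul_comm b a, ← neg_sub (a ^ 2), neg_sq] at h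
      linarith
end

section
/- Let x, y ∈ [0,1] and let ρ ≤ 0 satisfy ρ ≥ −√( x y / ((1−x)(1−y)) ) and ρ ≥ −√( (1−x)(1−y) / (x y) ) (interpreted as x y ≥ (1−x)(1−y)ρ² and (1−x)(1−y) ≥ x y ρ²). Then 1 − x y ≥ (3/4) · ( 1 − x y − ρ √( (x − x²)(y − y²) ) ). -/
theorem stmt14 (x y ρ : ℝ) (hx : x ∈ Set.Icc (0 : ℝ) 1) (hy : y ∈ Set.Icc (0 : ℝ) 1)
    (hρ : ρ ≤ 0)
    (hfeas1 : x * y ≥ (1 - x) * (1 - y) * ρ ^ 2)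
    (hfeas2 : (1 - x) * (1 - y) ≥ x * y * ρ ^ 2) :
    1 - x * y ≥ 3 / 4 * (1 - x * y - ρ * Real.sqrt ((x - x ^ 2) * (y - y ^ 2))) := by
  obtain ⟨hx0, hx1⟩ := hx
  obtain ⟨hy0, hy1⟩ := hy
  have hP : 0 ≤ x * y := mul_nonneg hx0 hy0
  have hQ : 0 ≤ (1 - x) * (1 - y) := mul_nonneg (sub_nonneg.2 hx1) (sub_nonneg.2 hy1)
  have hS : (x - x ^ 2) * (y - y ^ 2) = (x * y) * ((1 - x) * (1 - y)) := by ring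
  have hsq : (-ρ * √((x - x ^ 2) * (y - y ^ 2))) ^ 2
      = ρ ^ 2 * ((x * y) * ((1 - x) * (1 - y))) := by
    rw [mul_pow, hS, Real.sq_sqrt (mul_nonneg hP hQ), neg_sq]
  have hleP : -ρ * √((x - x ^ 2) * (y - y ^ 2)) ≤ x * y := by
    refine le_of_abs_le (abs_le_of_sq_le_sq ?_ hP)
    rw [hsq]
    linarith [mul_le_mul_of_nonneg_left hfeas1 hP]
  have hleQ : -ρ * √((x - x ^ 2) * (y - y ^ 2)) ≤ (1 - x) * (1 - y) := by
    refine le_of_abs_le (abs_le_of_sq_le_sq ?_ hQ)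
    rw [hsq]
    linarith [mul_le_mul_of_nonneg_left hfeas2 hQ]
  rcases le_total (x * y) (1 / 4) with h | h
  · linarith
  · have hsum : 1 ≤ x + y := by nlinarith [sq_nonneg (x - y)]
    have hprod : 0 ≤ (x + y - 1) * (2 - (x + y)) :=
      mul_nonneg (by linarith) (by linarith)
    linarith [sq_nonneg (x - y)]
end

section
/- Let (Ω, P) be a probability space and Z_i, Z_j, Z_k : Ω → {−1, +1} random variables whose joint distribution is symmetric under global negation, i.e. P[Z_i = α, Z_j = β, Z_k = γ] = P[Z_i = −α, Z_j = −β, Z_k = −γ] for all α, β, γ ∈ {−1,+1}. Then for all α, β, γ ∈ {−1,+1}: P[Z_i = α, Z_j = β, Z_k = γ] = (1/2) · ( P[Z_i = α, Z_j = β] + P[Z_i = α, Z_k = γ] + P[Z_j = β, Z_k = γ] − 1/2 ). -/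
open MeasureTheory

/-- Splitting an event according to the value of a sign-valued random variable. -/
theorem measure_toReal_split_sign {Ω : Type*} [MeasurableSpace Ω] (μ : Measure Ω)
    [IsFiniteMeasure μ] {Z : Ω → ℝ} (hZm : Measurable Z) (hZ : ∀ ω, Z ω = 1 ∨ Z ω = -1)
    {c : ℝ} (hc : c = 1 ∨ c = -1) (p : Ω → Prop) :
    (μ {ω | p ω}).toReal =
      (μ {ω | p ω ∧ Z ω = c}).toReal + (μ {ω | p ω ∧ Z ω = -c}).toReal := by
  have hdiff : {ω | p ω} \ {ω | Z ω = c} = {ω | p ω ∧ Z ω = -c} := by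
    ext ω
    have h : ¬ Z ω = c ↔ Z ω = -c := by
      rcases hZ ω with h | h <;> rcases hc with rfl | rfl <;> rw [h] <;> norm_num
    exact and_congr_right fun _ => h
  rw [← hdiff]
  exact (measureReal_inter_add_sdiff (μ := μ) (s := {ω | p ω})
    (hZm (measurableSet_singleton c))).symm

theorem stmt15 {Ω : Type*} [MeasurableSpace Ω] (μ : Measure Ω) [IsProbabilityMeasure μ]
    (Zi Zj Zk : Ω → ℝ)
    (hZim : Measurable Zi) (hZjm : Measurable Zj) (hZkm : Measurable Zk)
    (hZi : ∀ ω, Zi ω = 1 ∨ Zi ω = -1)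
    (hZj : ∀ ω, Zj ω = 1 ∨ Zj ω = -1)
    (hZk : ∀ ω, Zk ω = 1 ∨ Zk ω = -1)
    (hsym : ∀ α β γ : ℝ, (α = 1 ∨ α = -1) → (β = 1 ∨ β = -1) → (γ = 1 ∨ γ = -1) →
      μ {ω | Zi ω = α ∧ Zj ω = β ∧ Zk ω = γ} =
        μ {ω | Zi ω = -α ∧ Zj ω = -β ∧ Zk ω = -γ})
    (α β γ : ℝ) (hα : α = 1 ∨ α = -1) (hβ : β = 1 ∨ β = -1) (hγ : γ = 1 ∨ γ = -1) :
    (μ {ω | Zi ω = α ∧ Zj ω = β ∧ Zk ω = γ}).toReal =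
      1 / 2 * ((μ {ω | Zi ω = α ∧ Zj ω = β}).toReal
        + (μ {ω | Zi ω = α ∧ Zk ω = γ}).toReal
        + (μ {ω | Zj ω = β ∧ Zk ω = γ}).toReal - 1 / 2) := by
  have hα' : -α = 1 ∨ -α = -1 := by rcases hα with rfl | rfl <;> norm_num
  have hβ' : -β = 1 ∨ -β = -1 := by rcases hβ with rfl | rfl <;> norm_num
  have hγ' : -γ = 1 ∨ -γ = -1 := by rcases hγ with rfl | rfl <;> norm_num
  have htotal := measure_toReal_split_sign μ hZim hZi hα (fun _ => True)
  have hi := measure_toReal_split_sign μ hZjm hZj hβ (fun ω => Zi ω = α)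
  have hi' := measure_toReal_split_sign μ hZjm hZj hβ (fun ω => Zi ω = -α)
  have hij := measure_toReal_split_sign μ hZkm hZk hγ (fun ω => Zi ω = α ∧ Zj ω = β)
  have hij₁ := measure_toReal_split_sign μ hZkm hZk hγ (fun ω => Zi ω = α ∧ Zj ω = -β)
  have hij₂ := measure_toReal_split_sign μ hZkm hZk hγ (fun ω => Zi ω = -α ∧ Zj ω = β)
  have hij₃ := measure_toReal_split_sign μ hZkm hZk hγ (fun ω => Zi ω = -α ∧ Zj ω = -β)
  have hik := measure_toReal_split_sign μ hZjm hZj hβ (fun ω => Zi ω = α ∧ Zk ω = γ)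
  have hjk := measure_toReal_split_sign μ hZim hZi hα (fun ω => Zj ω = β ∧ Zk ω = γ)
  have hrot (a b c : ℝ) : {ω | (Zj ω = b ∧ Zk ω = c) ∧ Zi ω = a} =
      {ω | Zi ω = a ∧ Zj ω = b ∧ Zk ω = c} := by
    ext ω; simp only [Set.mem_ofPred_eq]; tauto
  have hswap (a b c : ℝ) : {ω | (Zi ω = a ∧ Zk ω = c) ∧ Zj ω = b} =
      {ω | Zi ω = a ∧ Zj ω = b ∧ Zk ω = c} := by
    ext ω; simp only [Set.mem_ofPred_eq]; tauto
  simp only [true_and, Set.ofPred_true, measure_univ, ENNReal.toReal_one] at htotal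
  rw [hrot, hrot] at hjk
  rw [hswap, hswap] at hik
  simp only [and_assoc] at hij hij₁ hij₂ hij₃
  have h₀ := congrArg ENNReal.toReal (hsym α β γ hα hβ hγ)
  have h₁ := congrArg ENNReal.toReal (hsym α β (-γ) hα hβ hγ')
  have h₂ := congrArg ENNReal.toReal (hsym α (-β) γ hα hβ' hγ)
  have h₃ := congrArg ENNReal.toReal (hsym (-α) β γ hα' hβ hγ)
  simp only [neg_neg] at h₁ h₂ h₃
  linarith
end
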